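/- Let N ≥ 2, p ≥ 2, p < N, and let Ω ⊂ ℝ^N be a bounded domain containing 0 with D = sup_{x∈Ω}|x|. Then for all u ∈ C_c^∞(Ω ∖ {0}), ∫_Ω |∇u|^p dx − ((N−p)/p)^p ∫_Ω |u|^p/|x|^p dx ≥ ((p−1)/(2p)) ((N−p)/p)^{p−2} ∫_Ω (|u|^p/|x|^p) X_1(|x|/D)^2 dx, where X_1(t) = (1 − log t)^{−1}. -/

import Mathlib

open Real MeasureTheory

theorem one_add_rpow_le_quadratic {q g : ℝ} (hq1 : 1 ≤ q) (hq2 : q ≤ 2) (hg : 0 ≤ g) :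
    (1 + g) ^ q ≤ 1 + q * g + q * (q - 1) / 2 * g ^ 2 := by
  have hd : ∀ y : ℝ, 0 ≤ y → HasDerivAt
      (fun y : ℝ => 1 + q * y + q * (q - 1) / 2 * y ^ 2 - (1 + y) ^ q)
      (q * (1 + (q - 1) * y - (1 + y) ^ (q - 1))) y := by
    intro y hy
    have h1 : HasDerivAt (fun y : ℝ => (1 + y) ^ q) (1 * q * (1 + y) ^ (q - 1)) y :=
      ((hasDerivAt_id y).const_add 1).rpow_const (Or.inr hq1)
    have h2 := ((((hasDerivAt_id y).const_mul q).const_add 1).add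
      ((hasDerivAt_pow 2 y).const_mul (q * (q - 1) / 2))).sub h1
    refine h2.congr_deriv ?_
    norm_num
    ring
  have hmono : MonotoneOn (fun y : ℝ => 1 + q * y + q * (q - 1) / 2 * y ^ 2 - (1 + y) ^ q)
      (Set.Ici 0) := by
    refine monotoneOn_of_deriv_nonneg (convex_Ici 0)
      (fun y hy => (hd y hy).continuousAt.continuousWithinAt) ?_ ?_
    · intro y hy
      exact (hd y (interior_subset hy)).differentiableAt.differentiableWithinAt
    · intro y hy
      have hy0 : (0 : ℝ) ≤ y := interior_subset hy
      rw [(hd y hy0).deriv]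
      have := rpow_one_add_le_one_add_mul_self (s := y) (by linarith) (p := q - 1)
        (by linarith) (by linarith)
      exact mul_nonneg (by linarith) (by linarith)
  have := hmono (Set.mem_Ici.2 le_rfl) (Set.mem_Ici.2 hg) hg
  norm_num at this
  linarith

theorem integrable_fderiv_apply_self {N : ℕ} {φ : EuclideanSpace ℝ (Fin N) → ℝ}
    (hφ : ContDiff ℝ 1 φ) (hc : HasCompactSupport φ) :
    Integrable (fun x => fderiv ℝ φ x x) := by
  refine Continuous.integrable_of_hasCompactSupport
    ((hφ.continuous_fderiv one_ne_zero).clm_apply continuous_id) ?_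
  refine (hc.fderiv (𝕜 := ℝ)).mono fun x hx => ?_
  contrapose! hx
  simp [Function.notMem_support.1 hx]

theorem integral_fderiv_apply_self {N : ℕ} {φ : EuclideanSpace ℝ (Fin N) → ℝ}
    (hφ : ContDiff ℝ 1 φ) (hc : HasCompactSupport φ) :
    ∫ x, fderiv ℝ φ x x = -(N * ∫ x, φ x) := by
  let e : Fin N → EuclideanSpace ℝ (Fin N) := fun i => EuclideanSpace.single i 1
  have hsum : ∀ x : EuclideanSpace ℝ (Fin N),
      fderiv ℝ φ x x = ∑ i, x i * fderiv ℝ φ x (e i) := by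
    intro x
    have hx : x = ∑ i, x i • e i := by
      ext j
      simp [e, Finset.sum_apply, Pi.single_apply]
    have := congrArg (fderiv ℝ φ x) hx
    rw [map_sum] at this
    simpa using this
  have hcoord : ∀ (i : Fin N) (x : EuclideanSpace ℝ (Fin N)),
      HasFDerivAt (fun y : EuclideanSpace ℝ (Fin N) => y i)
        (EuclideanSpace.proj i : EuclideanSpace ℝ (Fin N) →L[ℝ] ℝ) x :=
    fun i x => (EuclideanSpace.proj i : EuclideanSpace ℝ (Fin N) →L[ℝ] ℝ).hasFDerivAt
  have hcd : ∀ i, Continuous fun x => fderiv ℝ φ x (e i) := fun i =>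
    (hφ.continuous_fderiv one_ne_zero).clm_apply continuous_const
  have hci : ∀ i : Fin N, Continuous fun x : EuclideanSpace ℝ (Fin N) => x i := fun i =>
    (EuclideanSpace.proj i : EuclideanSpace ℝ (Fin N) →L[ℝ] ℝ).continuous
  have hint : ∀ i, Integrable (fun x : EuclideanSpace ℝ (Fin N) => x i * fderiv ℝ φ x (e i)) :=
    fun i => ((hci i).mul (hcd i)).integrable_of_hasCompactSupport
      ((hc.fderiv_apply (𝕜 := ℝ) (e i)).mul_left)
  have hfd : ∀ i x, fderiv ℝ (fun y : EuclideanSpace ℝ (Fin N) => y i) x (e i) = 1 := by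
    intro i x
    rw [(hcoord i x).fderiv]
    simp [e]
  have hparts : ∀ i, ∫ x : EuclideanSpace ℝ (Fin N), x i * fderiv ℝ φ x (e i) = -∫ x, φ x := by
    intro i
    have := integral_mul_fderiv_eq_neg_fderiv_mul_of_integrable (μ := volume)
      (f := fun y : EuclideanSpace ℝ (Fin N) => y i) (g := φ) (v := e i)
      (by simpa only [hfd, one_mul] using hφ.continuous.integrable_of_hasCompactSupport hc)
      (hint i)
      (((hci i).mul hφ.continuous).integrable_of_hasCompactSupport hc.mul_left)
      (fun x _ => (hcoord i x).differentiableAt)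
      (fun x _ => (hφ.differentiable one_ne_zero) x)
    simpa only [hfd, one_mul] using this
  simp_rw [hsum]
  rw [integral_finsetSum _ fun i _ => hint i]
  simp [hparts]

theorem hardy_scalar_inequality {p H X : ℝ} (hp : 2 ≤ p) (hH : 0 < H) (hX : 0 ≤ X) :
    H ^ p + (p - 1) / (2 * p) * H ^ (p - 2) * X ^ 2 +
        (p - 1) * H ^ p * (1 + (p - 1) / (p * H) * X) ^ (p / (p - 1)) ≤
      H ^ (p - 1) * (p * H * (1 + (p - 1) / (p * H) * X) + (p - 1) / (p * H) * X ^ 2) := by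
  have h1 : 0 < p - 1 := by linarith
  have hE : 0 < H ^ (p - 2) := rpow_pos_of_pos hH _
  have e1 : H ^ (p - 1) = H ^ (p - 2) * H := by
    rw [← rpow_add_one hH.ne']; ring_nf
  have e2 : H ^ p = H ^ (p - 2) * H ^ 2 := by
    rw [← rpow_natCast H 2, ← rpow_add hH]; norm_num
  have hquad := one_add_rpow_le_quadratic (q := p / (p - 1)) (g := (p - 1) / (p * H) * X)
    (by rw [le_div_iff₀ h1]; linarith) (by rw [div_le_iff₀ h1]; linarith) (by positivity)
  have key : H ^ p + (p - 1) / (2 * p) * H ^ (p - 2) * X ^ 2 + (p - 1) * H ^ p *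
      (1 + p / (p - 1) * ((p - 1) / (p * H) * X) +
        p / (p - 1) * (p / (p - 1) - 1) / 2 * ((p - 1) / (p * H) * X) ^ 2) =
      H ^ (p - 1) * (p * H * (1 + (p - 1) / (p * H) * X) + (p - 1) / (p * H) * X ^ 2) := by
    rw [e1, e2]
    field_simp
    ring
  rw [← key]
  gcongr

theorem hardy_pointwise_inequality {p H X r a s d n : ℝ} (hp : 2 ≤ p) (hH : 0 < H) (hX : 0 ≤ X)
    (hr : 0 < r) (ha : 0 ≤ a) (hd : |d| ≤ a * r) (hn : n = p + p * H) :
    H ^ p * (|s| ^ p / r ^ p) + (p - 1) / (2 * p) * H ^ (p - 2) * (|s| ^ p / r ^ p * X ^ 2) ≤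
      a ^ p + (n * (|s| ^ p * (H ^ (p - 1) * (r ^ (-p) * (1 + (p - 1) / (p * H) * X)))) +
        (|s| ^ p * (H ^ (p - 1) * (r ^ (-p) *
            (-p * (1 + (p - 1) / (p * H) * X) + (p - 1) / (p * H) * X ^ 2))) +
          p * |s| ^ (p - 2) * s * d *
            (H ^ (p - 1) * (r ^ (-p) * (1 + (p - 1) / (p * H) * X))))) := by
  have h1 : 0 < p - 1 := by linarith
  have hscal := hardy_scalar_inequality hp hH hX
  set f := 1 + (p - 1) / (p * H) * X with hf
  have hf0 : 0 < f := by positivity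
  have hM : 0 ≤ |s| ^ p * r ^ (-p) := by positivity
  have hscal' := mul_le_mul_of_nonneg_left hscal hM
  have hq : p.HolderConjugate (p / (p - 1)) := Real.HolderConjugate.conjExponent (by linarith)
  have hy := young_inequality_of_nonneg ha
    (b := |s| ^ (p - 1) * (H ^ (p - 1) * (r ^ (1 - p) * f))) (by positivity) hq
  have hpow : ∀ z : ℝ, 0 ≤ z → (z ^ (p - 1)) ^ (p / (p - 1)) = z ^ p := by
    intro z hz
    rw [← rpow_mul hz]; congr 1; field_simp
  have hpow' : (r ^ (1 - p)) ^ (p / (p - 1)) = r ^ (-p) := by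
    rw [← rpow_mul hr.le]; congr 1; field_simp; ring
  rw [mul_rpow (by positivity) (by positivity), mul_rpow (by positivity) (by positivity),
    mul_rpow (by positivity) (by positivity), hpow _ (abs_nonneg s), hpow _ hH.le, hpow'] at hy
  have hy' : p * (a * (|s| ^ (p - 1) * (H ^ (p - 1) * (r ^ (1 - p) * f)))) ≤
      a ^ p + (p - 1) * (|s| ^ p * (H ^ p * (r ^ (-p) * f ^ (p / (p - 1))))) := by
    refine (mul_le_mul_of_nonneg_left hy (by linarith)).trans_eq ?_
    field_simp
  have hs : |s| ^ (p - 2) * |s| = |s| ^ (p - 1) := by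
    rcases eq_or_ne s 0 with rfl | hs
    · simp [zero_rpow h1.ne']
    · rw [← rpow_add_one (abs_ne_zero.2 hs)]; ring_nf
  have hr1 : r ^ (-p) * r = r ^ (1 - p) := by
    rw [← rpow_add_one hr.ne']; ring_nf
  have habs : -(p * (a * (|s| ^ (p - 1) * (H ^ (p - 1) * (r ^ (1 - p) * f))))) ≤
      p * |s| ^ (p - 2) * s * d * (H ^ (p - 1) * (r ^ (-p) * f)) := by
    refine neg_le_of_abs_le ?_
    have : |p * |s| ^ (p - 2) * s * d * (H ^ (p - 1) * (r ^ (-p) * f))| =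
        p * |s| ^ (p - 2) * |s| * |d| * (H ^ (p - 1) * (r ^ (-p) * f)) := by
      simp only [abs_mul, abs_of_pos hf0, abs_of_pos (rpow_pos_of_pos hH (p - 1)),
        abs_of_pos (rpow_pos_of_pos hr (-p)), abs_of_pos (show 0 < p by linarith),
        abs_of_nonneg (rpow_nonneg (abs_nonneg s) (p - 2))]
    rw [this]
    calc p * |s| ^ (p - 2) * |s| * |d| * (H ^ (p - 1) * (r ^ (-p) * f))
        ≤ p * |s| ^ (p - 2) * |s| * (a * r) * (H ^ (p - 1) * (r ^ (-p) * f)) := by gcongr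
      _ = _ := by rw [← hs, ← hr1]; ring
  have hdiv : |s| ^ p / r ^ p = |s| ^ p * r ^ (-p) := by
    rw [rpow_neg hr.le, div_eq_mul_inv]
  rw [hdiv, hn]
  linear_combination hscal' + hy' + habs

theorem integrable_abs_rpow_mul {E : Type*} [NormedAddCommGroup E] [MeasureSpace E] [BorelSpace E]
    [IsFiniteMeasureOnCompacts (volume : Measure E)] {u g : E → ℝ} {p : ℝ} (hp : 0 < p)
    (hu : Continuous u) (hc : HasCompactSupport u) (hg : ∀ x ∈ tsupport u, ContinuousAt g x) :
    Integrable (fun x => |u x| ^ p * g x) := by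
  have hsub : Function.support (fun x => |u x| ^ p * g x) ⊆ tsupport u := by
    intro x hx
    by_contra hxu
    exact hx (by simp [image_eq_zero_of_notMem_tsupport hxu, zero_rpow hp.ne'])
  refine (integrableOn_iff_integrable_of_support_subset hsub).1 ?_
  refine ContinuousOn.integrableOn_compact hc fun x hx => ?_
  exact (((hu.abs.rpow_const fun _ => Or.inr hp.le).continuousAt).mul
    (hg x hx)).continuousWithinAt

theorem contDiff_abs_rpow_mul {E : Type*} [NormedAddCommGroup E] [NormedSpace ℝ E]
    {u w : E → ℝ} {p : ℝ} (hp : 1 < p) (hu : ContDiff ℝ 1 u)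
    (hw : ∀ x ∈ tsupport u, ContDiffAt ℝ 1 w x) :
    ContDiff ℝ 1 (fun x => |u x| ^ p * w x) := by
  refine contDiff_iff_contDiffAt.2 fun x => ?_
  by_cases hx : x ∈ tsupport u
  · exact (hu.norm_rpow hp).contDiffAt.mul (hw x hx)
  · refine (contDiffAt_const (c := (0 : ℝ))).congr_of_eventuallyEq ?_
    filter_upwards [notMem_tsupport_iff_eventuallyEq.1 hx] with y hy
    simp [hy, zero_rpow (by linarith : p ≠ 0)]

theorem hasDerivAt_hardy_weight {p c A D r : ℝ} (hr : 0 < r) (hD : 0 < D) (hrD : r ≤ D) :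
    HasDerivAt (fun r => A * (r ^ (-p) * (1 + c * (1 - log (r / D))⁻¹)))
      (A * (r ^ (-p) * (-p * (1 + c * (1 - log (r / D))⁻¹) + c * ((1 - log (r / D))⁻¹) ^ 2)) / r)
      r := by
  have hlog : log (r / D) ≤ 0 :=
    log_nonpos (by positivity) (by rw [div_le_one hD]; exact hrD)
  have hne : 1 - log (r / D) ≠ 0 := by linarith
  have h1 : HasDerivAt (fun r => 1 - log (r / D)) (-(1 / D / (r / D))) r :=
    (((hasDerivAt_id r).div_const D).log (by positivity)).const_sub 1
  have h2 := ((h1.inv hne).const_mul c).const_add 1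
  have h3 : HasDerivAt (fun r : ℝ => r ^ (-p)) (-p * r ^ (-p - 1)) r :=
    hasDerivAt_rpow_const (Or.inl hr.ne')
  refine ((h3.mul h2).const_mul A).congr_deriv ?_
  rw [rpow_sub_one hr.ne']
  simp only [Pi.inv_apply]
  field_simp

theorem fderiv_abs_rpow_mul_radial {E : Type*} [NormedAddCommGroup E] [InnerProductSpace ℝ E]
    {u : E → ℝ} {W : ℝ → ℝ} {W' p : ℝ} {x : E} (hp : 1 < p) (hx : x ≠ 0)
    (hu : DifferentiableAt ℝ u x) (hW : HasDerivAt W W' ‖x‖) :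
    fderiv ℝ (fun y => |u y| ^ p * W ‖y‖) x x =
      |u x| ^ p * (W' * ‖x‖) + p * |u x| ^ (p - 2) * u x * fderiv ℝ u x x * W ‖x‖ := by
  have hn : DifferentiableAt ℝ (fun y : E => ‖y‖) x :=
    (contDiffAt_norm (n := 1) ℝ hx).differentiableAt one_ne_zero
  have h1 := (hasDerivAt_abs_rpow (u x) hp).comp_hasFDerivAt x hu.hasFDerivAt
  have h2 := hW.comp_hasFDerivAt x hn.hasFDerivAt
  have h3 := h1.mul h2
  have h4 : fderiv ℝ (fun y => |u y| ^ p * W ‖y‖) x = _ := h3.fderiv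
  rw [h4]
  simp [hn.fderiv_norm_self]
  ring

theorem improved_hardy_point {N : ℕ} (hN : 2 ≤ N) (p : ℝ) (hp2 : 2 ≤ p) (hpN : p < N)
    (Ω : Set (EuclideanSpace ℝ (Fin N))) (hΩ : IsOpen Ω) (hΩconn : IsConnected Ω)
    (hΩb : Bornology.IsBounded Ω) (h0 : (0 : EuclideanSpace ℝ (Fin N)) ∈ Ω)
    (D : ℝ) (hD : D = ⨆ x ∈ Ω, ‖x‖)
    (u : EuclideanSpace ℝ (Fin N) → ℝ) (hu : ContDiff ℝ (⊤ : ℕ∞) u)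
    (hsupp : HasCompactSupport u) (hsupp' : tsupport u ⊆ Ω \ {0}) :
    (∫ x in Ω, ‖gradient u x‖ ^ p) -
        (((N : ℝ) - p) / p) ^ p * ∫ x in Ω, |u x| ^ p / ‖x‖ ^ p ≥
      ((p - 1) / (2 * p)) * (((N : ℝ) - p) / p) ^ (p - 2) *
        ∫ x in Ω, (|u x| ^ p / ‖x‖ ^ p) * ((1 - Real.log (‖x‖ / D))⁻¹) ^ 2 := by
  have hp0 : 0 < p := by linarith
  have hp1 : 1 < p := by linarith
  have hle : ∀ x ∈ Ω, ‖x‖ ≤ D := by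
    obtain ⟨R, hR⟩ := hΩb.exists_norm_le
    intro x hx
    have hbdd : BddAbove (Set.range fun y : EuclideanSpace ℝ (Fin N) => ⨆ _ : y ∈ Ω, ‖y‖) := by
      refine ⟨max R 0, ?_⟩
      rintro _ ⟨y, rfl⟩
      by_cases hy : y ∈ Ω
      · simp [hy, hR y hy]
      · simp [hy]
    have := le_ciSup hbdd x
    rw [hD]
    simpa [hx] using this
  have hmem : ∀ x ∈ tsupport u, 0 < ‖x‖ ∧ ‖x‖ ≤ D := fun x hx =>
    ⟨norm_pos_iff.2 (hsupp' hx).2, hle x (hsupp' hx).1⟩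
  have hlog : ∀ x ∈ tsupport u, 1 - log (‖x‖ / D) ≠ 0 ∧ 0 ≤ (1 - log (‖x‖ / D))⁻¹ ∧ D ≠ 0 := by
    intro x hx
    obtain ⟨h1, h2⟩ := hmem x hx
    have hD0 : 0 < D := h1.trans_le h2
    have : log (‖x‖ / D) ≤ 0 := log_nonpos (by positivity) (by rwa [div_le_one hD0])
    exact ⟨by linarith, inv_nonneg.2 (by linarith), hD0.ne'⟩
  set H : ℝ := ((N : ℝ) - p) / p with hHdef
  have hH : 0 < H := div_pos (by linarith) hp0
  have hn : (N : ℝ) = p + p * H := by rw [hHdef]; field_simp; ring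
  have hu1 : ContDiff ℝ 1 u := hu.of_le (by exact_mod_cast le_top)
  have hzero : ∀ x, x ∉ Ω → x ∉ tsupport u := fun x hx h => hx (hsupp' h).1
  have hgrad : ∀ x, ‖gradient u x‖ = ‖fderiv ℝ u x‖ := fun x => by simp [gradient]
  rw [setIntegral_eq_integral_of_forall_compl_eq_zero (fun x hx => by
      rw [hgrad, fderiv_of_notMem_tsupport ℝ (hzero x hx), norm_zero, zero_rpow hp0.ne']),
    setIntegral_eq_integral_of_forall_compl_eq_zero (fun x hx => by
      simp [image_eq_zero_of_notMem_tsupport (hzero x hx), zero_rpow hp0.ne']),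
    setIntegral_eq_integral_of_forall_compl_eq_zero (fun x hx => by
      simp [image_eq_zero_of_notMem_tsupport (hzero x hx), zero_rpow hp0.ne'])]
  simp_rw [hgrad]
  set W : ℝ → ℝ := fun r =>
    H ^ (p - 1) * (r ^ (-p) * (1 + (p - 1) / (p * H) * (1 - log (r / D))⁻¹)) with hW
  set φ : EuclideanSpace ℝ (Fin N) → ℝ := fun x => |u x| ^ p * W ‖x‖ with hφdef
  have hWc : ∀ x ∈ tsupport u,
      ContDiffAt ℝ 1 (fun y : EuclideanSpace ℝ (Fin N) => W ‖y‖) x := by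
    intro x hx
    obtain ⟨h1, h2⟩ := hmem x hx
    have hD0 : 0 < D := h1.trans_le h2
    have hnorm : ContDiffAt ℝ 1 (fun y : EuclideanSpace ℝ (Fin N) => ‖y‖) x :=
      contDiffAt_norm ℝ (norm_pos_iff.1 h1)
    exact contDiffAt_const.mul ((hnorm.rpow_const_of_ne h1.ne').mul (contDiffAt_const.add
      (contDiffAt_const.mul ((contDiffAt_const.sub
        ((hnorm.div_const D).log (by positivity))).inv (hlog x hx).1))))
  have hφ : ContDiff ℝ 1 φ := contDiff_abs_rpow_mul hp1 hu1 hWc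
  have hφc : HasCompactSupport φ := hsupp.mono fun x hx => by
    contrapose! hx
    simp [hφdef, Function.notMem_support.1 hx, zero_rpow hp0.ne']
  have hi1 : Integrable (fun x => ‖fderiv ℝ u x‖ ^ p) := by
    refine Continuous.integrable_of_hasCompactSupport
      ((hu1.continuous_fderiv one_ne_zero).norm.rpow_const fun _ => Or.inr hp0.le) ?_
    refine (hsupp.fderiv (𝕜 := ℝ)).mono fun x hx => ?_
    contrapose! hx
    simp [Function.notMem_support.1 hx, zero_rpow hp0.ne']
  have hnc : ∀ x ∈ tsupport u,
      ContinuousAt (fun y : EuclideanSpace ℝ (Fin N) => (‖y‖ ^ p)⁻¹) x := fun x hx =>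
    (continuous_norm.continuousAt.rpow_const (Or.inr hp0.le)).inv₀
      (rpow_pos_of_pos (hmem x hx).1 p).ne'
  have hi2 : Integrable (fun x => |u x| ^ p / ‖x‖ ^ p) := by
    simp_rw [div_eq_mul_inv]
    exact integrable_abs_rpow_mul hp0 hu.continuous hsupp hnc
  have hi3 : Integrable (fun x => |u x| ^ p / ‖x‖ ^ p * ((1 - log (‖x‖ / D))⁻¹) ^ 2) := by
    simp_rw [div_eq_mul_inv (|u _| ^ p), mul_assoc]
    refine integrable_abs_rpow_mul hp0 hu.continuous hsupp fun x hx => ?_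
    refine (hnc x hx).mul (((continuousAt_const.sub
      ((continuous_norm.continuousAt.div_const D).log ?_)).inv₀ (hlog x hx).1).pow 2)
    exact div_ne_zero (hmem x hx).1.ne' (hlog x hx).2.2
  have hi4 : Integrable φ := hφ.continuous.integrable_of_hasCompactSupport hφc
  have hi5 := integrable_fderiv_apply_self hφ hφc
  have hpt : ∀ x, H ^ p * (|u x| ^ p / ‖x‖ ^ p) + (p - 1) / (2 * p) * H ^ (p - 2) *
      (|u x| ^ p / ‖x‖ ^ p * ((1 - log (‖x‖ / D))⁻¹) ^ 2) ≤
      ‖fderiv ℝ u x‖ ^ p + (N * φ x + fderiv ℝ φ x x) := by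
    intro x
    by_cases hx : x ∈ tsupport u
    · obtain ⟨h1, h2⟩ := hmem x hx
      rw [fderiv_abs_rpow_mul_radial hp1 (norm_pos_iff.1 h1)
        (hu1.differentiable one_ne_zero x)
        (hasDerivAt_hardy_weight h1 (h1.trans_le h2) h2), div_mul_cancel₀ _ h1.ne']
      exact hardy_pointwise_inequality hp2 hH (hlog x hx).2.1 h1 (norm_nonneg _)
        ((fderiv ℝ u x).le_opNorm x) hn
    · have hxφ : x ∉ tsupport φ := fun h => hx (by
        refine closure_mono (fun y hy => ?_) h
        contrapose! hy
        simp [hφdef, Function.notMem_support.1 hy, zero_rpow hp0.ne'])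
      rw [fderiv_of_notMem_tsupport ℝ hx, fderiv_of_notMem_tsupport ℝ hxφ,
        image_eq_zero_of_notMem_tsupport hxφ, image_eq_zero_of_notMem_tsupport hx]
      simp [zero_rpow hp0.ne']
  have hfin := integral_mono ((hi2.const_mul _).add (hi3.const_mul _))
    (hi1.add ((hi4.const_mul _).add hi5)) hpt
  rw [integral_add' (hi2.const_mul _) (hi3.const_mul _), integral_const_mul, integral_const_mul,
    integral_add' hi1 ((hi4.const_mul _).add hi5), integral_add' (hi4.const_mul _) hi5,
    integral_const_mul, integral_fderiv_apply_self hφ hφc] at hfin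
  linarith
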